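/- arXiv:2512.08479 — 6 statements merged into one kernel-verified Lean document; each statement's English description precedes it below -/
import Mathlib

section
/- Let L, Q ≥ 1 and let Ω₀,…,Ω_{Q−1} be symmetric positive definite L×L real matrices with ∑_{ζ=0}^{Q−1} Ω_ζ = I. Then for all vectors f₀,…,f_{Q−1} ∈ ℝ^L, one has |∑_{ζ=0}^{Q−1} f_ζ|² ≤ ∑_{ζ=0}^{Q−1} f_ζᵀ Ω_ζ⁻¹ f_ζ, where |·| is the Euclidean norm on ℝ^L. -/
open Matrix

/-- The Fenchel–Young inequality for the quadratic form of a positive definite matrix. -/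
theorem Matrix.PosDef.two_mul_dotProduct_le {n : Type*} [Fintype n] [DecidableEq n]
    {A : Matrix n n ℝ} (hA : A.PosDef) (x y : n → ℝ) :
    2 * (x ⬝ᵥ y) ≤ x ⬝ᵥ A *ᵥ x + y ⬝ᵥ A⁻¹ *ᵥ y := by
  have h := hA.inv.posSemidef.dotProduct_mulVec_nonneg (y - A *ᵥ x)
  have hdet : IsUnit A.det := (isUnit_iff_isUnit_det A).1 hA.isUnit
  have hxy : A *ᵥ x ⬝ᵥ A⁻¹ *ᵥ y = x ⬝ᵥ y := by
    have hT : Aᵀ = A := by simpa using hA.isHermitian.eq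
    rw [dotProduct_mulVec, ← mulVec_transpose, transpose_nonsing_inv, hT, mulVec_mulVec,
      nonsing_inv_mul A hdet, one_mulVec]
  simp only [star_trivial, mulVec_sub, mulVec_mulVec, nonsing_inv_mul A hdet, one_mulVec,
    sub_dotProduct, dotProduct_sub, hxy] at h
  linarith [dotProduct_comm x y, dotProduct_comm x (A *ᵥ x)]

/-- For symmetric positive definite matrices `Ω ζ` summing to the identity, the total
quadratic kinetic entropy dominates the macroscopic entropy of the moment. -/
theorem stmt2 (L Q : ℕ) (hL : 1 ≤ L) (hQ : 1 ≤ Q)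
    (Ω : Fin Q → Matrix (Fin L) (Fin L) ℝ)
    (hpd : ∀ ζ, (Ω ζ).PosDef) (hsum : ∑ ζ, Ω ζ = 1)
    (f : Fin Q → Fin L → ℝ) :
    ∑ l, (∑ ζ, f ζ l)^2 ≤ ∑ ζ, f ζ ⬝ᵥ ((Ω ζ)⁻¹).mulVec (f ζ) := by
  have h := Finset.sum_le_sum fun ζ (_ : ζ ∈ Finset.univ) =>
    (hpd ζ).two_mul_dotProduct_le (∑ ξ, f ξ) (f ζ)
  rw [Finset.sum_add_distrib, ← Finset.mul_sum, ← dotProduct_sum, ← dotProduct_sum,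
    ← sum_mulVec, hsum, one_mulVec] at h
  have hq : ∑ l, (∑ ζ, f ζ l) ^ 2 = (∑ ζ, f ζ) ⬝ᵥ (∑ ζ, f ζ) := by
    simp [dotProduct, sq]
  linarith
end

section
/- Let L, Q ≥ 1 and let Ω₀,…,Ω_{Q−1} be symmetric positive definite L×L real matrices with ∑_{ζ=0}^{Q−1} Ω_ζ = I, and define h_ζ(f) := ½ fᵀ Ω_ζ⁻¹ f. Given f₀,…,f_{Q−1} ∈ ℝ^L, set q := ∑_{ζ} f_ζ and define the projection step with relaxation parameter ω = 1 by f^{1/2}_ζ := Ω_ζ q. Then ∑_{ζ=0}^{Q−1} h_ζ(f^{1/2}_ζ) ≤ ∑_{ζ=0}^{Q−1} h_ζ(f_ζ). -/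
open Matrix

/-- Convexity of the kinetic entropy: its graph lies above the tangent at `A *ᵥ q`. -/
theorem Matrix.PosDef.two_mul_dotProduct_sub_le {n : Type*} [Fintype n] [DecidableEq n]
    {A : Matrix n n ℝ} (hA : A.PosDef) (q g : n → ℝ) :
    2 * (q ⬝ᵥ g) - q ⬝ᵥ A *ᵥ q ≤ g ⬝ᵥ A⁻¹ *ᵥ g := by
  have hdet : IsUnit A.det := (Matrix.isUnit_iff_isUnit_det A).mp hA.isUnit
  have hT : Aᵀ = A := by simpa using hA.isHermitian.eq
  have h := hA.inv.posSemidef.dotProduct_mulVec_nonneg (g - A *ᵥ q)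
  have hcancel : A⁻¹ *ᵥ A *ᵥ q = q := by
    rw [Matrix.mulVec_mulVec, Matrix.nonsing_inv_mul A hdet, Matrix.one_mulVec]
  have hcross : (A *ᵥ q) ⬝ᵥ A⁻¹ *ᵥ g = q ⬝ᵥ g := by
    rw [← Matrix.vecMul_transpose, hT, ← Matrix.dotProduct_mulVec, Matrix.mulVec_mulVec,
      Matrix.mul_nonsing_inv A hdet, Matrix.one_mulVec]
  rw [star_trivial, Matrix.mulVec_sub, hcancel, sub_dotProduct, dotProduct_sub, dotProduct_sub,
    hcross, dotProduct_comm g q, dotProduct_comm (A *ᵥ q) q] at h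
  linarith

/-- The projection step with `ω = 1` does not increase the total kinetic entropy. -/
theorem stmt3 (L Q : ℕ) (hL : 1 ≤ L) (hQ : 1 ≤ Q)
    (Ω : Fin Q → Matrix (Fin L) (Fin L) ℝ)
    (hpd : ∀ ζ, (Ω ζ).PosDef) (hsum : ∑ ζ, Ω ζ = 1)
    (f : Fin Q → Fin L → ℝ) :
    let h : Fin Q → (Fin L → ℝ) → ℝ := fun ζ g => (1/2) * (g ⬝ᵥ ((Ω ζ)⁻¹).mulVec g)
    let q : Fin L → ℝ := ∑ ζ, f ζ
    ∑ ζ, h ζ ((Ω ζ).mulVec q) ≤ ∑ ζ, h ζ (f ζ) := by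
  intro h q
  have hmax : ∀ ζ, h ζ ((Ω ζ).mulVec q) = (1/2) * (q ⬝ᵥ Ω ζ *ᵥ q) := fun ζ => by
    have hdet : IsUnit (Ω ζ).det := (Matrix.isUnit_iff_isUnit_det _).mp (hpd ζ).isUnit
    simp only [h]
    rw [Matrix.mulVec_mulVec, Matrix.nonsing_inv_mul _ hdet, Matrix.one_mulVec, dotProduct_comm]
  have hquad : ∑ ζ, q ⬝ᵥ Ω ζ *ᵥ q = q ⬝ᵥ q := by
    rw [← dotProduct_sum, ← Matrix.sum_mulVec, hsum, Matrix.one_mulVec]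
  have hlin : ∑ ζ, q ⬝ᵥ f ζ = q ⬝ᵥ q := by
    rw [← dotProduct_sum]
  have hle := Finset.sum_le_sum fun ζ (_ : ζ ∈ Finset.univ) =>
    (hpd ζ).two_mul_dotProduct_sub_le q (f ζ)
  rw [Finset.sum_sub_distrib, ← Finset.mul_sum, hlin, hquad] at hle
  simp only [hmax]
  simp only [h]
  rw [← Finset.mul_sum, ← Finset.mul_sum, hquad]
  linarith
end

section
/- Let L, Q ≥ 1 and let Ω₀,…,Ω_{Q−1} be symmetric positive definite L×L real matrices with ∑_{ζ=0}^{Q−1} Ω_ζ = I, and define h_ζ(f) := ½ fᵀ Ω_ζ⁻¹ f. Given f₀,…,f_{Q−1} ∈ ℝ^L, set q := ∑_{ζ} f_ζ and define the projection step with relaxation parameter ω = 2 by f^{1/2}_ζ := 2 Ω_ζ q − f_ζ. Then ∑_{ζ=0}^{Q−1} h_ζ(f^{1/2}_ζ) = ∑_{ζ=0}^{Q−1} h_ζ(f_ζ). -/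
open Matrix

/-- The reflection `g ↦ 2 A q - g` changes the quadratic form of `A⁻¹` by `4 (qᵀ A q - qᵀ g)`. -/
theorem Matrix.IsSymm.dotProduct_inv_mulVec_reflection {n : Type*} [Fintype n] [DecidableEq n]
    {A : Matrix n n ℝ} (hA : A.IsSymm) (hdet : IsUnit A.det) (q g : n → ℝ) :
    ((2 : ℝ) • A *ᵥ q - g) ⬝ᵥ A⁻¹ *ᵥ ((2 : ℝ) • A *ᵥ q - g) =
      g ⬝ᵥ A⁻¹ *ᵥ g + 4 * (q ⬝ᵥ A *ᵥ q - q ⬝ᵥ g) := by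
  have hinv : A⁻¹ *ᵥ (A *ᵥ q) = q := by
    rw [mulVec_mulVec, nonsing_inv_mul _ hdet, one_mulVec]
  have hcross : (A *ᵥ q) ⬝ᵥ A⁻¹ *ᵥ g = q ⬝ᵥ g := by
    rw [← vecMul_transpose, hA.eq, ← dotProduct_mulVec, mulVec_mulVec,
      mul_nonsing_inv _ hdet, one_mulVec]
  simp only [mulVec_sub, mulVec_smul, hinv, sub_dotProduct, dotProduct_sub, smul_dotProduct,
    dotProduct_smul, hcross, smul_eq_mul, dotProduct_comm g q, dotProduct_comm (A *ᵥ q) q]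
  ring

/-- The projection step with `ω = 2` conserves the total kinetic entropy exactly. -/
theorem stmt4 (L Q : ℕ) (hL : 1 ≤ L) (hQ : 1 ≤ Q)
    (Ω : Fin Q → Matrix (Fin L) (Fin L) ℝ)
    (hpd : ∀ ζ, (Ω ζ).PosDef) (hsum : ∑ ζ, Ω ζ = 1)
    (f : Fin Q → Fin L → ℝ) :
    let h : Fin Q → (Fin L → ℝ) → ℝ := fun ζ g => (1/2) * (g ⬝ᵥ ((Ω ζ)⁻¹).mulVec g)
    let q : Fin L → ℝ := ∑ ζ, f ζ
    ∑ ζ, h ζ ((2 : ℝ) • (Ω ζ).mulVec q - f ζ) = ∑ ζ, h ζ (f ζ) := by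
  intro h q
  have hstep (ζ : Fin Q) : h ζ ((2 : ℝ) • (Ω ζ).mulVec q - f ζ) =
      h ζ (f ζ) + 2 * (q ⬝ᵥ Ω ζ *ᵥ q - q ⬝ᵥ f ζ) := by
    have hsymm : (Ω ζ).IsSymm := by
      simpa [IsHermitian, IsSymm, conjTranspose_eq_transpose_of_trivial] using (hpd ζ).isHermitian
    simp only [h, hsymm.dotProduct_inv_mulVec_reflection (hpd ζ).det_pos.ne'.isUnit]
    ring
  have hbalance : ∑ ζ, (q ⬝ᵥ Ω ζ *ᵥ q - q ⬝ᵥ f ζ) = 0 := by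
    rw [Finset.sum_sub_distrib, ← dotProduct_sum, ← dotProduct_sum, ← sum_mulVec, hsum,
      one_mulVec, sub_self]
  simp_rw [hstep]
  rw [Finset.sum_add_distrib, ← Finset.mul_sum _ _ (2 : ℝ), hbalance, mul_zero, add_zero]
end

section
/- Let c > 0, λ > 0 and α, γ ∈ ℝ satisfy 0 ≤ α ≤ 1/2, 0 ≤ γ ≤ 1/4, and αγ ≥ c²/(4λ²). Define the symmetric 6×6 real matrix B whose only nonzero entries are B₁₁ = B₅₅ = 2λ²α − c², B₃₃ = B₆₆ = 2λ²γ − c², and B₁₅ = B₅₁ = −c². Then B is positive semidefinite. -/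
open Matrix

/-- Under the entropy-stability conditions of the D2Q5 kinetic scheme, the diffusion
matrix `B` of the equivalent-equation analysis is positive semidefinite. -/
theorem stmt10 (c lam α γ : ℝ) (hc : 0 < c) (hlam : 0 < lam)
    (hα0 : 0 ≤ α) (hα : α ≤ 1/2) (hγ0 : 0 ≤ γ) (hγ : γ ≤ 1/4)
    (hcfl : c ^ 2 / (4 * lam ^ 2) ≤ α * γ) :
    (!![2 * lam ^ 2 * α - c ^ 2, 0, 0, 0, -c ^ 2, 0;
       0, 0, 0, 0, 0, 0;
       0, 0, 2 * lam ^ 2 * γ - c ^ 2, 0, 0, 0;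
       0, 0, 0, 0, 0, 0;
       -c ^ 2, 0, 0, 0, 2 * lam ^ 2 * α - c ^ 2, 0;
       0, 0, 0, 0, 0, 2 * lam ^ 2 * γ - c ^ 2] : Matrix (Fin 6) (Fin 6) ℝ).PosSemidef := by
  have hcfl' : c ^ 2 ≤ α * γ * (4 * lam ^ 2) := (div_le_iff₀ (by positivity)).mp hcfl
  have h_diag_α : 0 ≤ 2 * lam ^ 2 * α - c ^ 2 - c ^ 2 := by
    have := mul_nonneg (mul_nonneg (sq_nonneg lam) hα0) (sub_nonneg.mpr hγ)
    linarith
  have h_diag_γ : 0 ≤ 2 * lam ^ 2 * γ - c ^ 2 := by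
    have := mul_nonneg (mul_nonneg (sq_nonneg lam) hγ0) (sub_nonneg.mpr hα)
    linarith
  refine PosSemidef.of_dotProduct_mulVec_nonneg ?_ fun x ↦ ?_
  · ext i j
    fin_cases i <;> fin_cases j <;> simp
  · have h_form : 0 ≤ (2 * lam ^ 2 * α - c ^ 2 - c ^ 2) * (x 0 ^ 2 + x 4 ^ 2) +
        c ^ 2 * (x 0 - x 4) ^ 2 + (2 * lam ^ 2 * γ - c ^ 2) * (x 2 ^ 2 + x 5 ^ 2) := by
      positivity
    refine h_form.trans_eq ?_
    simp [dotProduct, mulVec, Fin.sum_univ_succ]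
    ring
end

section
/- Let c > 0. For all α, γ, λ ∈ ℝ with 0 ≤ α ≤ 1/2, 0 ≤ γ ≤ 1/4, λ > 0 and 4αγλ² ≥ c², define J(α,γ,λ) := (2λ²α − c²)² + (2λ²γ − c²)². Then J(α,γ,λ) ≥ c⁴, and equality J(α,γ,λ) = c⁴ holds if and only if α = 1/2, γ = 1/4 and λ = √2 c. -/
/-- The numerical-diffusion functional `J` over the entropy-stability region is minimized
exactly at `α = 1/2`, `γ = 1/4`, `λ = √2 c`. -/
theorem stmt11 (c : ℝ) (hc : 0 < c) :
    ∀ α γ lam : ℝ, 0 ≤ α → α ≤ 1/2 → 0 ≤ γ → γ ≤ 1/4 → 0 < lam →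
      4 * α * γ * lam^2 ≥ c^2 →
      (2 * lam^2 * α - c^2)^2 + (2 * lam^2 * γ - c^2)^2 ≥ c^4 ∧
      ((2 * lam^2 * α - c^2)^2 + (2 * lam^2 * γ - c^2)^2 = c^4 ↔
        (α = 1/2 ∧ γ = 1/4 ∧ lam = Real.sqrt 2 * c)) := by
  intro α γ lam hα _ _ hγ hlam h
  have hs : 0 < c^2 := by positivity
  have hX0 : 0 ≤ 2 * lam^2 * α := by positivity
  have hX : 2 * c^2 ≤ 2 * lam^2 * α := by
    nlinarith [mul_nonneg hX0 (sub_nonneg.2 hγ)]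
  have hX2 : c^4 ≤ (2 * lam^2 * α - c^2)^2 := by
    nlinarith
  refine ⟨by nlinarith [sq_nonneg (2 * lam^2 * γ - c^2)], fun hJ => ?_, ?_⟩
  · have hY : 2 * lam^2 * γ = c^2 := by
      have : (2 * lam^2 * γ - c^2)^2 = 0 :=
        le_antisymm (by linarith) (sq_nonneg _)
      linarith [pow_eq_zero_iff (two_ne_zero) |>.1 this]
    have hXeq : 2 * lam^2 * α = 2 * c^2 := by
      rw [hY] at hJ
      nlinarith
    have hγeq : γ = 1/4 := by
      refine le_antisymm hγ ?_
      have : 4 * α * γ * lam^2 = 4 * c^2 * γ := by linear_combination 2 * γ * hXeq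
      nlinarith
    subst hγeq
    have hl : lam^2 = 2 * c^2 := by linarith
    refine ⟨?_, rfl, ?_⟩
    · rw [hl] at hXeq
      have : c^2 * (4 * α - 2) = 0 := by linarith
      rcases mul_eq_zero.1 this with h0 | h0 <;> linarith
    · rw [← Real.sqrt_sq hlam.le, hl, Real.sqrt_mul (by norm_num), Real.sqrt_sq hc.le]
  · rintro ⟨rfl, rfl, rfl⟩
    rw [mul_pow, Real.sq_sqrt (by norm_num)]
    ring
end

section
/- Let ω, ω₁, ω₂ ∈ ℝ, let R be the 3×3 matrix with rows (0,−1,0), (1,0,0), (0,0,1), let Ω₁ be any symmetric 3×3 real matrix, set Ω_ζ := R^{ζ−1} Ω₁ R^{−(ζ−1)} for ζ ∈ {1,2,3,4} and Ω₀ := diag(ω₁, ω₁, ω₂). Let e₀ = (0,0), e₁ = (1,0), e₂ = (0,1), e₃ = (−1,0), e₄ = (0,−1) ∈ ℤ², let σ : ℤ² → ℤ² be σ(i,j) = (−j,i), and let τ be the permutation of {0,1,2,3,4} fixing 0 and acting cyclically by τ(1)=2, τ(2)=3, τ(3)=4, τ(4)=1 (so that e_{τ(ζ)} = σ(e_ζ)).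 Consider two solutions f^n, g^n of the kinetic scheme f^{n+1}_ζ(p + e_ζ) = (1−ω) f^n_ζ(p) + ω Ω_ζ (∑_{η=0}^{4} f^n_η(p)) on functions {0,…,4} → (ℤ² → ℝ³). If g⁰_{τ(ζ)}(σ(p)) = R f⁰_ζ(p) for all ζ and p, then for every n ≥ 0 one has g^n_{τ(ζ)}(σ(p)) = R f^n_ζ(p) for all ζ and p; in particular the moments satisfy ∑_ζ g^n_ζ(σ(p)) = R (∑_ζ f^n_ζ(p)) for all n and p. -/
open Matrix

/-- The moments of two families of densities related by a permutation of the speeds, a map of the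
grid and a matrix `R` are themselves related by `R`. -/
theorem moment_equivariant {ι κ P A : Type*} [Fintype ι] [Fintype κ] [CommRing A]
    {R : Matrix κ κ A} {σ : P → P} (τ : Equiv.Perm ι) {f g : ι → P → κ → A}
    (h : ∀ ζ p, g (τ ζ) (σ p) = R *ᵥ f ζ p) (p : P) :
    ∑ ζ, g ζ (σ p) = R *ᵥ ∑ ζ, f ζ p := by
  rw [← Equiv.sum_comp τ, Matrix.mulVec_sum]
  exact Finset.sum_congr rfl fun ζ _ => h ζ p

/-- A kinetic scheme whose shifts and Maxwellian matrices are intertwined by a grid endomorphism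
`σ`, a permutation `τ` of the speeds and a matrix `R` preserves this symmetry in time. -/
theorem kineticScheme_equivariant {ι κ P A : Type*} [Fintype ι] [Fintype κ] [AddGroup P]
    [CommRing A] {ω : A} {R : Matrix κ κ A} {Ω : ι → Matrix κ κ A} {e : ι → P} {σ : P →+ P}
    {τ : Equiv.Perm ι} (he : ∀ ζ, e (τ ζ) = σ (e ζ)) (hΩ : ∀ ζ, Ω (τ ζ) * R = R * Ω ζ)
    {f g : ℕ → ι → P → κ → A}
    (hf : ∀ n ζ p, f (n + 1) ζ (p + e ζ) = (1 - ω) • f n ζ p + ω • (Ω ζ *ᵥ ∑ η, f n η p))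
    (hg : ∀ n ζ p, g (n + 1) ζ (p + e ζ) = (1 - ω) • g n ζ p + ω • (Ω ζ *ᵥ ∑ η, g n η p))
    (h₀ : ∀ ζ p, g 0 (τ ζ) (σ p) = R *ᵥ f 0 ζ p) (n : ℕ) (ζ : ι) (p : P) :
    g n (τ ζ) (σ p) = R *ᵥ f n ζ p := by
  induction n generalizing ζ p with
  | zero => exact h₀ ζ p
  | succ n ih =>
    obtain ⟨q, rfl⟩ : ∃ q, p = q + e ζ := ⟨p - e ζ, (sub_add_cancel p _).symm⟩
    rw [map_add, ← he, hg, hf, ih, moment_equivariant τ ih, Matrix.mulVec_add,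
      Matrix.mulVec_smul, Matrix.mulVec_smul, Matrix.mulVec_mulVec, Matrix.mulVec_mulVec, hΩ]

theorem Matrix.pow_succ_conj_mul {κ A : Type*} [Fintype κ] [DecidableEq κ] [CommRing A]
    {R : Matrix κ κ A} (hR : IsUnit R.det) (M : Matrix κ κ A) (k : ℕ) :
    R ^ (k + 1) * M * (R ^ (k + 1))⁻¹ * R = R * (R ^ k * M * (R ^ k)⁻¹) := by
  rw [pow_succ' R k, Matrix.mul_inv_rev, ← Matrix.mul_assoc,
    Matrix.nonsing_inv_mul_cancel_right _ _ hR]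
  simp only [Matrix.mul_assoc]

/-- π/2-rotation equivariance of the D2Q5 kinetic scheme with Maxwellian matrices
`Ω_ζ = R^{ζ-1} Ω₁ R^{-(ζ-1)}` (ζ = 1,…,4) and `Ω₀ = diag(ω₁, ω₁, ω₂)`. -/
theorem stmt14 (ω ω1 ω2 : ℝ) (Ω1 : Matrix (Fin 3) (Fin 3) ℝ) (hsym : Ω1.IsSymm) :
    let R : Matrix (Fin 3) (Fin 3) ℝ := !![0, -1, 0; 1, 0, 0; 0, 0, 1]
    let Ω : Fin 5 → Matrix (Fin 3) (Fin 3) ℝ := fun ζ =>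
      if ζ = 0 then Matrix.diagonal ![ω1, ω1, ω2]
      else R ^ (ζ.val - 1) * Ω1 * (R ^ (ζ.val - 1))⁻¹
    let e : Fin 5 → ℤ × ℤ := ![(0, 0), (1, 0), (0, 1), (-1, 0), (0, -1)]
    let σ : ℤ × ℤ → ℤ × ℤ := fun p => (-p.2, p.1)
    let τ : Fin 5 → Fin 5 := ![0, 2, 3, 4, 1]
    ∀ f g : ℕ → Fin 5 → (ℤ × ℤ) → Fin 3 → ℝ,
      (∀ n ζ p, f (n+1) ζ (p + e ζ) =
        (1 - ω) • f n ζ p + ω • (Ω ζ).mulVec (∑ η, f n η p)) →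
      (∀ n ζ p, g (n+1) ζ (p + e ζ) =
        (1 - ω) • g n ζ p + ω • (Ω ζ).mulVec (∑ η, g n η p)) →
      (∀ ζ p, g 0 (τ ζ) (σ p) = R.mulVec (f 0 ζ p)) →
      (∀ n ζ p, g n (τ ζ) (σ p) = R.mulVec (f n ζ p)) ∧
      (∀ n p, ∑ ζ, g n ζ (σ p) = R.mulVec (∑ ζ, f n ζ p)) := by
  intro R Ω e σ τ f g hf hg h₀
  have hdet : IsUnit R.det := by simp [R, Matrix.det_fin_three]
  have hR4 : R ^ 4 = 1 := by
    ext i j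
    fin_cases i <;> fin_cases j <;> simp [R, pow_succ, Matrix.mul_apply, Fin.sum_univ_three]
  have hΩ₀ : Matrix.diagonal ![ω1, ω1, ω2] * R = R * Matrix.diagonal ![ω1, ω1, ω2] := by
    ext i j
    fin_cases i <;> fin_cases j <;> simp [R]
  have hΩ : ∀ ζ, Ω (τ ζ) * R = R * Ω ζ := by
    intro ζ
    fin_cases ζ
    · exact hΩ₀
    · exact Matrix.pow_succ_conj_mul hdet Ω1 0
    · exact Matrix.pow_succ_conj_mul hdet Ω1 1
    · exact Matrix.pow_succ_conj_mul hdet Ω1 2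
    · have h := Matrix.pow_succ_conj_mul hdet Ω1 3
      rw [hR4, ← pow_zero R] at h
      exact h
  let σ' : ℤ × ℤ →+ ℤ × ℤ := (-AddMonoidHom.snd ℤ ℤ).prod (AddMonoidHom.fst ℤ ℤ)
  let τ' : Equiv.Perm (Fin 5) := Equiv.ofBijective τ (by decide)
  have he : ∀ ζ, e (τ' ζ) = σ' (e ζ) := by decide
  have key : ∀ n ζ p, g n (τ ζ) (σ p) = R *ᵥ f n ζ p :=
    kineticScheme_equivariant (σ := σ') (τ := τ') he hΩ hf hg h₀
  exact ⟨key, fun n => moment_equivariant τ' (key n)⟩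
end
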